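/- Assume Hypothesis (B) and suppose moreover that f^(δ)(x_1,…,x_{n−1},0) = 0 defines a smooth hypersurface in P^{n−2}. Let ω_1,…,ω_n and ξ_1,…,ξ_n be homogeneous polynomials in K[x_1,…,x_n] satisfying Σ_{i=1}^n (∂f^(δ)/∂x_i) ω_i = 0 and Σ_{i=1}^n (∂f^(δ')/∂x_i) ω_i = Σ_{i=1}^n (∂f^(δ)/∂x_i) ξ_i. Then f^(δ') ω_n lies in the ideal (∂f^(δ)/∂x_1,…,∂f^(δ)/∂x_{n−1}) of K[x_1,…,x_n]. -/

import Mathlib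

open MvPolynomial

noncomputable section

/-- A polynomial differential `m`-form over `K[x_1,…,x_n]`, recorded by its coefficients:
to each subset `T ⊆ {1,…,n}` of cardinality `m` (the index set `i_1 < ⋯ < i_m` of
`dx_{i_1} ∧ ⋯ ∧ dx_{i_m}`) we assign a polynomial coefficient. -/
abbrev MForm (K : Type*) [CommSemiring K] (n m : ℕ) : Type _ :=
  ∀ T : Finset (Fin n), T.card = m → MvPolynomial (Fin n) K

/-- The wedge product `dg ∧ ω` of the exterior derivative of `g` with an `m`-form `ω`:
its coefficient on `T = {i_0 < ⋯ < i_m}` is `∑ k, (-1)^k (∂g/∂x_{i_k}) ω(T \ {i_k})`. -/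
def wedgeD {K : Type*} [CommRing K] {n m : ℕ} (g : MvPolynomial (Fin n) K)
    (ω : MForm K n m) : MForm K n (m + 1) := fun T hT =>
  ∑ j ∈ T.attach,
    (-1 : MvPolynomial (Fin n) K) ^ (T.filter (fun i => i < j.1)).card *
      pderiv j.1 g * ω (T.erase j.1) (by rw [Finset.card_erase_of_mem j.2]; omega)

/-- `g` is homogeneous of (possibly negative) degree `d : ℤ`; by convention the only
homogeneous polynomial of negative degree is `0`. -/
def HomogZ {K : Type*} [CommSemiring K] {σ : Type*} (g : MvPolynomial σ K) (d : ℤ) : Prop :=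
  g = 0 ∨ ∃ d' : ℕ, (d' : ℤ) = d ∧ g.IsHomogeneous d'

/-- A list of ring elements is a regular sequence when each entry is a nonzerodivisor
modulo the ideal generated by the preceding entries. -/
def IsRegSeq {R : Type*} [CommRing R] (rs : List R) : Prop :=
  ∀ (i : ℕ) (hi : i < rs.length) (x : R),
    rs[i] * x ∈ Ideal.span {y | ∃ (j : ℕ) (hj : j < i), y = rs[j]'(hj.trans hi)} →
    x ∈ Ideal.span {y | ∃ (j : ℕ) (hj : j < i), y = rs[j]'(hj.trans hi)}

/-- The origin is an isolated critical point of (the polynomial map defined by) `h`: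
it is a common zero of all partial derivatives `∂h/∂x_i`, and there is a Zariski-open
neighborhood `U` of the origin (wlog a basic open set `u ≠ 0` with `u(0) ≠ 0`) on which
the origin is the only common zero of the `∂h/∂x_i`. -/
def IsIsolatedCriticalAtZero {K : Type*} [CommSemiring K] {σ : Type*}
    (h : MvPolynomial σ K) : Prop :=
  (∀ i, eval (0 : σ → K) (pderiv i h) = 0) ∧
  ∃ u : MvPolynomial σ K, eval (0 : σ → K) u ≠ 0 ∧
    ∀ y : σ → K, eval y u ≠ 0 → (∀ i, eval y (pderiv i h) = 0) → y = 0

/-- The dehomogenization of `F` in the affine chart `x_j = 1` of `ℙ^{n-1}`, centered at the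
point `a` (which should satisfy `a j = 1`): a polynomial in the `n-1` variables `i ≠ j`. -/
def chartPoly {K : Type*} [CommRing K] {n : ℕ} (F : MvPolynomial (Fin n) K) (j : Fin n)
    (a : Fin n → K) : MvPolynomial {i : Fin n // i ≠ j} K :=
  aeval (fun i : Fin n => if h : i = j then 1 else X ⟨i, h⟩ + C (a i)) F

/-- `g` is weighted homogeneous of total degree `d`: there are positive integer weights
`α_i` with gcd `1` such that every monomial of `g` has weighted degree `d`
(equivalently, `g(λ^{α_1}x_1,…) = λ^d g(x)`). -/
def IsWeightedHomogTD {K : Type*} [CommSemiring K] {σ : Type*} [Fintype σ]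
    (g : MvPolynomial σ K) (d : ℕ) : Prop :=
  ∃ α : σ → ℕ, (∀ i, 0 < α i) ∧ Finset.univ.gcd α = 1 ∧ IsWeightedHomogeneous α g d

/-- The hypersurface `h = 0` has a weighted homogeneous singularity at the origin, of total
degree `d`: the complete local ring `K[[x]]/(h)` is isomorphic as a `K`-algebra to
`K[[x]]/(g)` for some weighted homogeneous `g` of total degree `d`. -/
def WeightedHomogSing {K : Type*} [Field K] {σ : Type*} [Fintype σ]
    (h : MvPolynomial σ K) (d : ℕ) : Prop :=
  ∃ g : MvPolynomial σ K, IsWeightedHomogTD g d ∧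
    Nonempty ((MvPowerSeries σ K ⧸ Ideal.span {(h : MvPowerSeries σ K)}) ≃ₐ[K]
      MvPowerSeries σ K ⧸ Ideal.span {(g : MvPowerSeries σ K)})

/-- The common zero locus, in the projective space `ℙ^{n-1}`, of a set `S` of
(homogeneous) polynomials. -/
def projZeros {K : Type*} [Field K] {n : ℕ} (S : Set (MvPolynomial (Fin n) K)) :
    Set (Projectivization K (Fin n → K)) :=
  {x | ∃ (v : Fin n → K) (hv : v ≠ 0), Projectivization.mk K v hv = x ∧ ∀ g ∈ S, eval v g = 0}

/-- A homogeneous polynomial `G` in `m` variables defines a smooth hypersurface in `ℙ^{m-1}`: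
`G` and its partial derivatives have no common zero in `ℙ^{m-1}`. -/
def SmoothProj {K : Type*} [Field K] {σ : Type*} (G : MvPolynomial σ K) : Prop :=
  ∀ y : σ → K, y ≠ 0 → ¬ (eval y G = 0 ∧ ∀ i, eval y (pderiv i G) = 0)

/-- `F(x_1,…,x_{n-1},0)`, as a polynomial in the first `n-1` variables. -/
def truncAtLast {K : Type*} [CommRing K] {n : ℕ} (F : MvPolynomial (Fin n) K) :
    MvPolynomial (Fin (n - 1)) K :=
  aeval (fun i : Fin n => if h : (i : ℕ) < n - 1 then X (⟨i, h⟩ : Fin (n - 1)) else 0) F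

/-- `F(y_1,…,y_{n-1},1)`, as a polynomial in the first `n-1` variables. -/
def dehomAtLast {K : Type*} [CommRing K] {n : ℕ} (F : MvPolynomial (Fin n) K) :
    MvPolynomial (Fin (n - 1)) K :=
  aeval (fun i : Fin n => if h : (i : ℕ) < n - 1 then X (⟨i, h⟩ : Fin (n - 1)) else 1) F

/-- The point `(b, 1) ∈ K^n` lying over `b ∈ K^{n-1}` (affine chart `x_n = 1`). -/
def liftPt {K : Type*} [CommRing K] {n : ℕ} (b : Fin (n - 1) → K) : Fin n → K :=
  fun i => if h : (i : ℕ) < n - 1 then b ⟨i, h⟩ else 1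

/-- Context of the paper: `f` has degree `δ ≥ 2`, `1 ≤ δ' ≤ δ - 1`, and
`f = f^(δ) + f^(δ') + (terms of degree < δ')`, with `f^(δ')` the (nonzero) homogeneous
component of second-highest degree. -/
def Setup {K : Type*} [Field K] {n : ℕ} (δ δ' : ℕ) (f : MvPolynomial (Fin n) K) : Prop :=
  f.totalDegree = δ ∧ 2 ≤ δ ∧ 1 ≤ δ' ∧ δ' < δ ∧
  (∀ j, δ' < j → j < δ → homogeneousComponent j f = 0) ∧
  homogeneousComponent δ' f ≠ 0

/-- Hypothesis (A): `p ∤ δ`, `p ∤ δ'`; every singular point of the hypersurface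
`f^(δ) = 0` in `ℙ^{n-1}` (taken with a representative normalized by `a j = 1`) is an
isolated singularity, weighted homogeneous of some total degree `d` with `p ∤ d`,
and does not lie on the hypersurface `f^(δ') = 0`. -/
def HypA {K : Type*} [Field K] {n : ℕ} (p δ δ' : ℕ) (f : MvPolynomial (Fin n) K) : Prop :=
  ¬ (p ∣ δ) ∧ ¬ (p ∣ δ') ∧
  ∀ (a : Fin n → K) (j : Fin n), a j = 1 →
    eval a (homogeneousComponent δ f) = 0 →
    (∀ i, eval a (pderiv i (homogeneousComponent δ f)) = 0) →
    IsIsolatedCriticalAtZero (chartPoly (homogeneousComponent δ f) j a) ∧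
    (∃ d : ℕ, ¬ (p ∣ d) ∧ WeightedHomogSing (chartPoly (homogeneousComponent δ f) j a) d) ∧
    eval a (homogeneousComponent δ' f) ≠ 0

/-- Hypothesis (B): `p ∣ δ`, `p ∤ δ'`, the common zero locus of the `∂f^(δ)/∂x_i` in
`ℙ^{n-1}` is finite and nonempty, and none of its points lies on the hypersurface
`f^(δ') = 0`. -/
def HypB {K : Type*} [Field K] {n : ℕ} (p δ δ' : ℕ) (f : MvPolynomial (Fin n) K) : Prop :=
  (p ∣ δ) ∧ ¬ (p ∣ δ') ∧
  (projZeros {g | ∃ i, g = pderiv i (homogeneousComponent δ f)}).Finite ∧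
  (projZeros {g | ∃ i, g = pderiv i (homogeneousComponent δ f)}).Nonempty ∧
  ∀ a : Fin n → K, a ≠ 0 → (∀ i, eval a (pderiv i (homogeneousComponent δ f)) = 0) →
    eval a (homogeneousComponent δ' f) ≠ 0

/-- The localization of the polynomial ring at the maximal ideal of the point `b`. -/
instance evalKerPrime (K : Type*) [Field K] (σ : Type*) (b : σ → K) :
    (RingHom.ker (eval b : MvPolynomial σ K →+* K)).IsPrime := RingHom.ker_isPrime _

/-- The local ring of affine space at the point `b`, i.e. the localization of the
polynomial ring at the maximal ideal of polynomials vanishing at `b`. -/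
abbrev LocAt (K : Type*) [Field K] {σ : Type*} (b : σ → K) :=
  Localization.AtPrime (RingHom.ker (eval b : MvPolynomial σ K →+* K))

/-- The Milnor number of `h` at the point `b`: the `K`-dimension of the quotient of the
local ring at `b` by the ideal generated by the partial derivatives of `h`. -/
def milnorAt {K : Type*} [Field K] {σ : Type*} (b : σ → K) (h : MvPolynomial σ K) : ℕ :=
  Module.finrank K
    ((LocAt K b) ⧸ Ideal.span (Set.range fun i =>
      algebraMap (MvPolynomial σ K) (LocAt K b) (pderiv i h)))


section Kos
variable {R E M : Type*} [CommRing R] [AddCommGroup E] [Module R E]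
  [AddCommGroup M] [Module R M]

/-- the homotopy -/
theorem kos_homotopy (g : E) (α : E →ₗ[R] R) {i : ℕ} (φ : E [⋀^Fin (i+1)]→ₗ[R] M)
    (hφ : φ.curryLeft g = 0) :
    (AlternatingMap.alternatizeUncurryFin (α.smulRight φ)).curryLeft g = α g • φ := by
  ext v
  rw [AlternatingMap.curryLeft_apply_apply, AlternatingMap.alternatizeUncurryFin_apply,
    Fin.sum_univ_succ]
  have : ∀ k : Fin (i+1), φ (Fin.removeNth k.succ (Matrix.vecCons g v)) = 0 := by
    intro k
    have h : φ (Matrix.vecCons g (Fin.removeNth k v)) = 0 :=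
      DFunLike.congr_fun hφ (Fin.removeNth k v)
    refine Eq.trans ?_ h
    congr 1
    funext j
    refine Fin.cases ?_ (fun j => ?_) j <;> simp [Fin.removeNth]
  simp [this]

theorem alt_lift [Module.Free R E] {M' : Type*} [AddCommGroup M'] [Module R M'] {i : ℕ}
    (π : M →ₗ[R] M') (hπ : Function.Surjective π) (ψ : E [⋀^Fin i]→ₗ[R] M') :
    ∃ ψ' : E [⋀^Fin i]→ₗ[R] M, π.compAlternatingMap ψ' = ψ := by
  obtain ⟨h, hh⟩ := Module.projective_lifting_property π
    (exteriorPower.alternatingMapLinearEquiv ψ) hπ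
  refine ⟨h.compAlternatingMap (exteriorPower.ιMulti R i), ?_⟩
  conv_rhs => rw [← exteriorPower.alternatingMapLinearEquiv_comp_ιMulti ψ, ← hh]
  rfl

theorem alt_div {a : R} (ha : IsSMulRegular M a) {i : ℕ} (φ : E [⋀^Fin i]→ₗ[R] M)
    (h : ∀ v, ∃ m, φ v = a • m) : ∃ η : E [⋀^Fin i]→ₗ[R] M, φ = a • η := by
  choose f hf using h
  refine ⟨{ toFun := f, map_update_add' := ?_, map_update_smul' := ?_, map_eq_zero_of_eq' := ?_},
    ?_⟩
  · intro _ v j x y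
    apply ha
    simp only [smul_add, ← hf]
    convert φ.map_update_add v j x y
  · intro _ v j c x
    apply ha
    simp only
    rw [smul_comm a c]
    simp only [← hf]
    convert φ.map_update_smul v j c x
  · intro v j k hv hjk
    apply ha
    simp only [← hf, smul_zero]
    exact φ.map_eq_zero_of_eq v hv hjk
  · ext v
    exact hf v
end Kos

universe u
theorem kos_acyclic {R : Type u} [CommRing R] {r : ℕ} (g : Fin r → R) :
    ∀ (as : List R) (M : Type u) [AddCommGroup M] [Module R M]
      (_ : RingTheory.Sequence.IsWeaklyRegular M as)
      (_ : ∀ a ∈ as, ∃ α : (Fin r → R) →ₗ[R] R, α g = a) (i : ℕ)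
      (_ : r < i + 1 + as.length) (φ : (Fin r → R) [⋀^Fin (i+1)]→ₗ[R] M)
      (_ : φ.curryLeft g = 0),
      ∃ ψ : (Fin r → R) [⋀^Fin (i+2)]→ₗ[R] M, ψ.curryLeft g = φ := by
  intro as
  induction as with
  | nil =>
    intro M _ _ _ _ i hi φ _
    refine ⟨0, ?_⟩
    have : φ = 0 := by
      refine Module.Basis.ext_alternating (Pi.basisFun R (Fin r)) ?_
      intro v hv
      have := Fintype.card_le_of_injective v hv
      simp at this hi
      omega
    rw [this]; simp
  | cons a as ih =>
    intro M _ _ hreg hmem i hi φ hφ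
    rw [RingTheory.Sequence.isWeaklyRegular_cons_iff] at hreg
    obtain ⟨ha, hreg⟩ := hreg
    obtain ⟨α, hα⟩ := hmem a (by simp)
    have hh := kos_homotopy g α φ hφ
    set χ := AlternatingMap.alternatizeUncurryFin (α.smulRight φ)
    let π : M →ₗ[R] QuotSMulTop a M := Submodule.mkQ _
    have hπ : Function.Surjective π := Submodule.mkQ_surjective _
    have hker : ∀ m, π m = 0 ↔ ∃ y, m = a • y := by
      intro m
      simp only [π, Submodule.mkQ_apply, Submodule.Quotient.mk_eq_zero,
        Submodule.mem_smul_pointwise_iff_exists]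
      simp [eq_comm]
    obtain ⟨ψ', hψ'⟩ := ih (QuotSMulTop a M) hreg (fun b hb => hmem b (by simp [hb])) (i+1)
      (by simp at hi; omega) (π.compAlternatingMap χ) (by
        rw [AlternatingMap.curryLeft_compAlternatingMap, hh]
        ext v
        simp only [LinearMap.compAlternatingMap_apply, AlternatingMap.smul_apply, hα]
        exact (hker _).2 ⟨_, rfl⟩)
    obtain ⟨ψ, rfl⟩ := alt_lift π hπ ψ'
    obtain ⟨η, hη⟩ := alt_div ha (χ - ψ.curryLeft g) (by
      intro v
      rw [← hker]
      have := DFunLike.congr_fun hψ' v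
      rw [AlternatingMap.sub_apply, map_sub, sub_eq_zero]
      exact this.symm)
    refine ⟨η, ?_⟩
    have h3 : χ = ψ.curryLeft g + a • η := by rw [← hη]; abel
    rw [h3, AlternatingMap.curryLeft_add, LinearMap.add_apply, AlternatingMap.curryLeft_same,
      zero_add, AlternatingMap.curryLeft_smul, LinearMap.smul_apply, hα] at hh
    ext v
    apply ha
    exact DFunLike.congr_fun hh v

theorem kos_H1 {R : Type u} [CommRing R] {r : ℕ} (g : Fin r → R) (as : List R)
    (hreg : RingTheory.Sequence.IsWeaklyRegular R as) (hlen : as.length = r)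
    (hmem : ∀ a ∈ as, a ∈ Ideal.span (Set.range g)) (s : Fin r → R)
    (hs : ∑ i, g i * s i = 0) :
    ∃ c : Fin r → Fin r → R, (∀ i, c i i = 0) ∧ (∀ i j, c i j = - c j i) ∧
      ∀ j, s j = ∑ i, g i * c i j := by
  have lin : ∀ α : (Fin r → R) →ₗ[R] R, α g = ∑ i, g i * α (Pi.single i 1) := by
    intro α
    conv_lhs => rw [pi_eq_sum_univ' g, map_sum]
    simp only [map_smul, smul_eq_mul]
  let σ : (Fin r → R) →ₗ[R] R := ∑ i, s i • LinearMap.proj i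
  have hσ : ∀ v, σ v = ∑ i, s i * v i := by intro v; simp [σ]
  let φ : (Fin r → R) [⋀^Fin 1]→ₗ[R] R :=
    AlternatingMap.ofSubsingleton R _ R (0 : Fin 1) σ
  obtain ⟨ψ, hψ⟩ := kos_acyclic g as R hreg (by
    intro a ha
    obtain ⟨c, hc⟩ := Ideal.mem_span_range_iff_exists_fun.1 (hmem a ha)
    refine ⟨∑ i, c i • LinearMap.proj i, ?_⟩
    simpa using hc) 0 (by omega) φ (by
      ext v
      simp only [AlternatingMap.curryLeft_apply_apply, φ, AlternatingMap.ofSubsingleton_apply_apply]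
      simp [hσ]
      simpa [mul_comm] using hs)
  refine ⟨fun i j => ψ ![Pi.single i 1, Pi.single j 1], ?_, ?_, ?_⟩
  · intro i
    exact ψ.map_eq_zero_of_eq _ (i := 0) (j := 1) (by simp) (by simp)
  · intro i j
    have := ψ.map_swap ![Pi.single j 1, Pi.single i 1] (i := 0) (j := 1) (by simp)
    rw [← this]
    refine congrArg ψ ?_
    funext k
    fin_cases k <;> simp
  · intro j
    have h := DFunLike.congr_fun hψ ![Pi.single j 1]
    have h2 : φ ![Pi.single j 1] = s j := by
      simp only [φ, AlternatingMap.ofSubsingleton_apply_apply]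
      simp [hσ, Pi.single_apply]
    rw [h2] at h
    rw [← h]
    let τ : (Fin r → R) →ₗ[R] R :=
      { toFun := fun x => ψ.curryLeft x ![Pi.single j 1]
        map_add' := by intro x y; rw [map_add]; rfl
        map_smul' := by intro c x; rw [map_smul]; rfl }
    exact lin τ

theorem X_pow_weaklyRegular {K : Type*} [Field K] {n : ℕ} (N : Fin n → ℕ) :
    RingTheory.Sequence.IsWeaklyRegular (MvPolynomial (Fin n) K)
      (List.ofFn fun i => (X i : MvPolynomial (Fin n) K) ^ N i) := by
  constructor
  intro i hi
  rw [List.length_ofFn] at hi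
  have hspan : (Ideal.ofList ((List.ofFn fun i => (X i : MvPolynomial (Fin n) K) ^ N i).take i) •
      (⊤ : Submodule (MvPolynomial (Fin n) K) (MvPolynomial (Fin n) K)))
      = Ideal.span ((fun s => monomial s (1 : K)) ''
        {s | ∃ j : Fin n, (j : ℕ) < i ∧ s = Finsupp.single j (N j)}) := by
    rw [smul_eq_mul, Ideal.mul_top, Ideal.ofList]
    congr 1
    ext x
    simp only [Set.mem_ofPred_eq, Set.mem_image, List.mem_take_iff_getElem, List.getElem_ofFn]
    constructor
    · rintro ⟨j, hj, rfl⟩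
      simp only [List.length_ofFn] at hj
      refine ⟨_, ⟨⟨j, by omega⟩, by simp; omega, rfl⟩, ?_⟩
      rw [X_pow_eq_monomial]
    · rintro ⟨_, ⟨j, hj, rfl⟩, rfl⟩
      refine ⟨j, by simp; omega, ?_⟩
      rw [X_pow_eq_monomial]
  rw [isSMulRegular_quotient_iff_mem_of_smul_mem, hspan]
  intro x hx
  rw [mem_ideal_span_monomial_image] at hx ⊢
  intro m hm
  have h2 : Finsupp.single (⟨i, hi⟩ : Fin n) (N ⟨i, hi⟩) + m ∈
      ((List.ofFn fun i => (X i : MvPolynomial (Fin n) K) ^ N i)[i]'(by simpa using hi) • x).support := by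
    rw [List.getElem_ofFn, X_pow_eq_monomial, smul_eq_mul, mem_support_iff, coeff_monomial_mul]
    simpa using hm
  obtain ⟨s, ⟨j, hj, rfl⟩, hs⟩ := hx _ h2
  refine ⟨_, ⟨j, hj, rfl⟩, ?_⟩
  rw [Finsupp.single_le_iff] at hs ⊢
  rw [Finsupp.add_apply, Finsupp.single_eq_of_ne, zero_add] at hs
  · exact hs
  · intro h
    rw [Fin.ext_iff] at h
    simp at h
    omega

/-- `g` only vanishes at the origin implies `H_1 = 0`. -/
theorem syz_of_zeros {K : Type*} [Field K] [IsAlgClosed K] {n : ℕ}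
    (g : Fin n → MvPolynomial (Fin n) K)
    (hz : ∀ v : Fin n → K, (∀ i, eval v (g i) = 0) → v = 0)
    (s : Fin n → MvPolynomial (Fin n) K) (hs : ∑ i, g i * s i = 0) :
    ∃ c : Fin n → Fin n → MvPolynomial (Fin n) K, (∀ i, c i i = 0) ∧ (∀ i j, c i j = - c j i) ∧
      ∀ j, s j = ∑ i, g i * c i j := by
  have hrad : ∀ i : Fin n, ∃ N : ℕ, (X i : MvPolynomial (Fin n) K) ^ N ∈
      Ideal.span (Set.range g) := by
    intro i
    have : (X i : MvPolynomial (Fin n) K) ∈ (Ideal.span (Set.range g)).radical := by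
      rw [← vanishingIdeal_zeroLocus_eq_radical (K := K), mem_vanishingIdeal_iff]
      intro v hv
      have h0 : v = 0 := hz v fun i => by
        have := (mem_zeroLocus_iff.1 hv) (g i) (Ideal.subset_span ⟨i, rfl⟩)
        rwa [aeval_eq_eval] at this
      simp [h0]
    exact this
  choose N hN using hrad
  refine kos_H1 g _ (X_pow_weaklyRegular N) (by simp) ?_ s hs
  intro a ha
  rw [List.mem_ofFn] at ha
  obtain ⟨i, rfl⟩ := ha
  exact hN i

theorem mem_of_forall_pow {K : Type*} [Field K] {n : ℕ} (S : Set (MvPolynomial (Fin n) K))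
    (hS : ∀ x ∈ S, ∃ d, x.IsHomogeneous d) (l : MvPolynomial (Fin n) K) (e : ℕ) (he : 0 < e)
    (hl : l.IsHomogeneous e) (x : MvPolynomial (Fin n) K)
    (hx : ∀ N : ℕ, ∃ y z, y ∈ Ideal.span S ∧ x = y + l ^ N * z) : x ∈ Ideal.span S := by
  let _ := MvPolynomial.gradedAlgebra (σ := Fin n) (R := K)
  have hJ : (Ideal.span S).IsHomogeneous (homogeneousSubmodule (Fin n) K) := by
    apply Ideal.homogeneous_span
    intro x hx
    obtain ⟨d, hd⟩ := hS x hx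
    exact ⟨d, hd⟩
  have hJ' : ∀ y ∈ Ideal.span S, ∀ d, homogeneousComponent d y ∈ Ideal.span S := by
    intro y hy
    exact (mem_iff_homogeneousComponent_mem hJ y).1 hy
  rw [← sum_homogeneousComponent x]
  refine Ideal.sum_mem _ fun d _ => ?_
  obtain ⟨y, z, hy, h⟩ := hx (d+1)
  rw [h, map_add]
  have hz : homogeneousComponent d (l ^ (d+1) * z) = 0 := by
    rw [← sum_homogeneousComponent z, Finset.mul_sum, map_sum]
    refine Finset.sum_eq_zero fun k _ => ?_
    have h3 : (l ^ (d+1) * homogeneousComponent k z).IsHomogeneous (e * (d+1) + k) :=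
      (hl.pow _).mul (homogeneousComponent_isHomogeneous k z)
    rw [homogeneousComponent_of_mem h3, if_neg]
    nlinarith
  rw [hz, add_zero]
  exact hJ' y hy d

/-- key: syzygies of the first `n-1` elements have coefficients in the ideal. -/
theorem syz_mem {K : Type*} [Field K] [IsAlgClosed K] {n : ℕ} (L : Fin n)
    (F : Fin n → MvPolynomial (Fin n) K) (l : MvPolynomial (Fin n) K) (e : ℕ) (he : 0 < e)
    (hF : ∀ i, ∃ d, (F i).IsHomogeneous d) (hl : l.IsHomogeneous e)
    (hz : ∀ v : Fin n → K, (∀ i, i ≠ L → eval v (F i) = 0) → eval v l = 0 → v = 0)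
    (s : Fin n → MvPolynomial (Fin n) K) (hsL : s L = 0) (hs : ∑ i, F i * s i = 0) (j : Fin n) :
    s j ∈ Ideal.span {y | ∃ i, i ≠ L ∧ y = F i} := by
  have hmain : ∀ N : ℕ, ∃ t : Fin n → MvPolynomial (Fin n) K, t L = 0 ∧ ∑ i, F i * t i = 0 ∧
      ∀ j, ∃ y ∈ Ideal.span {y | ∃ i, i ≠ L ∧ y = F i}, s j = y + l ^ N * t j := by
    intro N
    induction N with
    | zero => exact ⟨s, hsL, hs, fun j => ⟨0, zero_mem _, by simp⟩⟩
    | succ N ih =>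
      obtain ⟨t, htL, ht, h⟩ := ih
      have hmemF : ∀ c : Fin n → MvPolynomial (Fin n) K,
          ∑ i ∈ Finset.univ.erase L, F i * c i ∈ Ideal.span {y | ∃ i, i ≠ L ∧ y = F i} := by
        intro c
        refine Ideal.sum_mem _ fun i hi => Ideal.mul_mem_right _ _ (Ideal.subset_span ⟨i, ?_, rfl⟩)
        simpa using hi
      have hsplit : ∀ c : Fin n → MvPolynomial (Fin n) K, ∑ i, Function.update F L l i * c i =
          ∑ i ∈ Finset.univ.erase L, F i * c i + l * c L := by
        intro c
        rw [← Finset.sum_erase_add _ _ (Finset.mem_univ L)]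
        congr 1
        · refine Finset.sum_congr rfl fun i hi => ?_
          rw [Function.update_of_ne (by simpa using hi)]
        · simp
      have hsplit2 : ∀ c : Fin n → MvPolynomial (Fin n) K, ∑ i, F i * c i =
          ∑ i ∈ Finset.univ.erase L, F i * c i + F L * c L := fun c =>
        (Finset.sum_erase_add _ _ (Finset.mem_univ L)).symm
      obtain ⟨c, hc0, hca, hc⟩ := syz_of_zeros (Function.update F L l) (by
        intro v hv
        refine hz v (fun i hi => ?_) ?_
        · simpa [hi] using hv i
        · simpa using hv L) t (by
        rw [hsplit, htL, mul_zero]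
        rw [hsplit2, htL, mul_zero] at ht
        exact ht)
      refine ⟨c L, hc0 L, ?_, ?_⟩
      · have := hc L
        rw [hsplit, htL, hc0, mul_zero, add_zero] at this
        rw [hsplit2, hc0, mul_zero, add_zero, ← neg_eq_zero, ← Finset.sum_neg_distrib]
        rw [this]
        refine Finset.sum_congr rfl fun i _ => ?_
        rw [hca L i]; ring
      · intro j
        obtain ⟨y, hy, hyj⟩ := h j
        refine ⟨y + l ^ N * ∑ i ∈ Finset.univ.erase L, F i * c i j,
          add_mem hy (Ideal.mul_mem_left _ _ (hmemF _)), ?_⟩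
        rw [hyj, hc j, hsplit]
        ring
  refine mem_of_forall_pow _ ?_ l e he hl _ ?_
  · rintro x ⟨i, _, rfl⟩
    exact hF i
  · intro N
    obtain ⟨t, _, _, h⟩ := hmain N
    obtain ⟨y, hy, h⟩ := h j
    exact ⟨y, t j, hy, h⟩

theorem trunc_pderiv {K : Type*} [CommRing K] {n : ℕ} (F : MvPolynomial (Fin n) K)
    (i : Fin (n-1)) :
    pderiv i (truncAtLast F) = truncAtLast (pderiv (⟨i, by omega⟩ : Fin n) F) := by
  induction F using MvPolynomial.induction_on with
  | C a => simp [truncAtLast, algebraMap_eq]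
  | add p q hp hq => simp only [truncAtLast, map_add] at *; rw [hp, hq]
  | mul_X p j hp =>
    simp only [truncAtLast] at *
    rw [map_mul, Derivation.leibniz, hp, Derivation.leibniz]
    simp only [smul_eq_mul, map_add, map_mul, aeval_X]
    congr 2
    by_cases h : (j : ℕ) < n - 1
    · simp only [dif_pos h, pderiv_X, Pi.single_apply]
      simp only [Fin.ext_iff]
      split_ifs <;> simp
    · have : j ≠ ⟨i, by omega⟩ := by intro hj; apply h; rw [hj]; exact i.2
      simp [dif_neg h, pderiv_X, this]

theorem eval_trunc {K : Type*} [CommRing K] {n : ℕ} (F : MvPolynomial (Fin n) K)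
    (v : Fin n → K) (hv : ∀ i : Fin n, ¬ (i : ℕ) < n - 1 → v i = 0) :
    eval (fun i : Fin (n-1) => v ⟨i, by omega⟩) (truncAtLast F) = eval v F := by
  induction F using MvPolynomial.induction_on with
  | C a => simp [truncAtLast, algebraMap_eq]
  | add p q hp hq => simp only [truncAtLast, map_add] at *; rw [hp, hq]
  | mul_X p j hp =>
    simp only [truncAtLast] at *
    rw [map_mul, map_mul, hp, map_mul, aeval_X, eval_X]
    congr 1
    by_cases h : (j : ℕ) < n - 1
    · simp [dif_pos h]
    · simp [dif_neg h, hv j h]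

theorem eval_smul_homog {K : Type*} [CommRing K] {n d : ℕ} (F : MvPolynomial (Fin n) K)
    (hF : F.IsHomogeneous d) (a : K) (v : Fin n → K) :
    eval (a • v) F = a ^ d * eval v F := by
  rw [eval_eq, eval_eq, Finset.mul_sum]
  refine Finset.sum_congr rfl fun m hm => ?_
  have hd : ∑ i ∈ m.support, m i = d := by
    have := hF (mem_support_iff.1 hm)
    simpa [Finsupp.weight_apply, Finsupp.sum] using this
  simp only [Pi.smul_apply, smul_eq_mul, mul_pow, Finset.prod_mul_distrib]
  rw [Finset.prod_pow_eq_pow_sum, hd]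
  ring

/-- Lemma 5.11: under Hypothesis (B) (with `f^(δ)(x_1,…,x_{n-1},0) = 0` a smooth
hypersurface in `ℙ^{n-2}`), if homogeneous `ω_1, …, ω_n` and `ξ_1, …, ξ_n` satisfy
`∑ (∂f^(δ)/∂x_i) ω_i = 0` and `∑ (∂f^(δ')/∂x_i) ω_i = ∑ (∂f^(δ)/∂x_i) ξ_i`, then
`f^(δ') ω_n ∈ (∂f^(δ)/∂x_1, …, ∂f^(δ)/∂x_{n-1})`. -/
theorem statement18 {K : Type*} [Field K] [IsAlgClosed K] (p : ℕ) [CharP K p]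
    (hp : p.Prime) {n : ℕ} (hn : 2 ≤ n) (f : MvPolynomial (Fin n) K) (δ δ' : ℕ)
    (hsetup : Setup δ δ' f) (hB : HypB p δ δ' f)
    (hsmooth : SmoothProj (truncAtLast (homogeneousComponent δ f)))
    (ω ξ : Fin n → MvPolynomial (Fin n) K)
    (hω : ∀ i, ∃ d, (ω i).IsHomogeneous d)
    (hξ : ∀ i, ∃ d, (ξ i).IsHomogeneous d)
    (h1 : ∑ i, pderiv i (homogeneousComponent δ f) * ω i = 0)
    (h2 : ∑ i, pderiv i (homogeneousComponent δ' f) * ω i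
        = ∑ i, pderiv i (homogeneousComponent δ f) * ξ i) :
    homogeneousComponent δ' f * ω ⟨n - 1, by omega⟩ ∈
      Ideal.span {y | ∃ j : Fin n, (j : ℕ) < n - 1 ∧
        y = pderiv j (homogeneousComponent δ f)} := by
  have hFh : (homogeneousComponent δ f).IsHomogeneous δ := homogeneousComponent_isHomogeneous δ f
  have hGh : (homogeneousComponent δ' f).IsHomogeneous δ' := homogeneousComponent_isHomogeneous δ' f
  obtain ⟨-, hδ2, -, -, -, -⟩ := hsetup
  obtain ⟨hpδ, hpδ', hfin, -, -⟩ := hB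
  generalize homogeneousComponent δ f = F at *
  generalize homogeneousComponent δ' f = G at *
  obtain ⟨L, hL⟩ : ∃ L : Fin n, L = ⟨n - 1, by omega⟩ := ⟨_, rfl⟩
  rw [← hL]
  have hLlt : ∀ j : Fin n, (j : ℕ) < n - 1 ↔ j ≠ L := by
    intro j
    rw [hL, ne_eq, Fin.ext_iff]
    simp only
    omega
  simp only [hLlt]
  have hEF : ∑ i, X i * pderiv i F = 0 := by
    rw [hFh.sum_X_mul_pderiv, nsmul_eq_mul, (CharP.cast_eq_zero_iff (MvPolynomial (Fin n) K) p δ).2 hpδ,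
      zero_mul]
  have hEG : ∑ i, X i * pderiv i G = δ' • G := hGh.sum_X_mul_pderiv
  obtain ⟨c, hc⟩ := (hfin.image
    (fun x => - eval x.rep F / (x.rep L) ^ δ)).exists_notMem
  have hlh : (F + C c * X L ^ δ).IsHomogeneous δ := by
    refine hFh.add ?_
    have := (isHomogeneous_C (Fin n) c).mul ((isHomogeneous_X K L).pow δ)
    simpa using this
  have hz : ∀ v : Fin n → K, (∀ i, i ≠ L → eval v (pderiv i F) = 0) →
      eval v (F + C c * X L ^ δ) = 0 → v = 0 := by
    intro v hv hl
    by_contra hv0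
    have hE : v L * eval v (pderiv L F) = 0 := by
      have := congrArg (eval v) hEF
      rw [map_sum, map_zero, Finset.sum_eq_single L] at this
      · simpa using this
      · intro i _ hi
        simp [hv i hi]
      · simp
    simp only [map_add, map_mul, eval_C, map_pow, eval_X] at hl
    by_cases hvL : v L = 0
    · rw [hvL, zero_pow (by omega), mul_zero, add_zero] at hl
      have hv' : ∀ i : Fin n, ¬ (i : ℕ) < n - 1 → v i = 0 := by
        intro i hi
        rw [hLlt, not_not] at hi
        rw [hi, hvL]
      refine hsmooth (fun i : Fin (n-1) => v ⟨i, by omega⟩) ?_ ⟨?_, ?_⟩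
      · intro h
        apply hv0
        funext i
        by_cases hi : (i : ℕ) < n - 1
        · exact congrFun h ⟨i, hi⟩
        · exact hv' i hi
      · rw [eval_trunc F v hv', hl]
      · intro i
        rw [trunc_pderiv, eval_trunc _ v hv']
        exact hv _ ((hLlt _).1 i.2)
    · have hFL := (mul_eq_zero.1 hE).resolve_left hvL
      apply hc
      refine ⟨Projectivization.mk K v hv0, ⟨v, hv0, rfl, ?_⟩, ?_⟩
      · rintro g ⟨i, rfl⟩
        by_cases hi : i = L
        · rw [hi, hFL]
        · exact hv i hi
      · obtain ⟨a, ha⟩ := Projectivization.exists_smul_eq_mk_rep K v hv0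
        simp only
        rw [← ha]
        have ha0 : (a : K) ≠ 0 := a.ne_zero
        have h3 : eval (a • v) F = (a : K) ^ δ * eval v F :=
          eval_smul_homog F hFh (a : K) v
        rw [h3]
        have h5 : (a • v) L = (a : K) * v L := rfl
        rw [h5, mul_pow, div_eq_iff (by positivity), eq_neg_of_add_eq_zero_left hl]
        ring
  have hFi : ∀ i, ∃ d, (pderiv i F).IsHomogeneous d := fun i => ⟨_, hFh.pderiv⟩
  have hs := syz_mem L (fun i => pderiv i F) _ δ (by omega) hFi hlh hz
    (fun i => X L * ω i - X i * ω L) (by simp) (by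
      have : ∀ i, pderiv i F * (X L * ω i - X i * ω L) =
          X L * (pderiv i F * ω i) - (X i * pderiv i F) * ω L := fun i => by ring
      simp only [this, Finset.sum_sub_distrib, ← Finset.mul_sum, ← Finset.sum_mul, h1, hEF]
      ring)
  set J := Ideal.span {y | ∃ j : Fin n, j ≠ L ∧ y = pderiv j F} with hJ
  have hFJ : ∀ i, i ≠ L → pderiv i F ∈ J := fun i hi => Ideal.subset_span ⟨i, hi, rfl⟩
  have hXL : X L * pderiv L F ∈ J := by
    have : X L * pderiv L F = - ∑ i ∈ Finset.univ.erase L, X i * pderiv i F := by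
      rw [eq_neg_iff_add_eq_zero, Finset.add_sum_erase _ (fun i => X i * pderiv i F) (Finset.mem_univ L), hEF]
    rw [this]
    refine neg_mem (Ideal.sum_mem _ fun i hi => Ideal.mul_mem_left _ _ (hFJ i (by simpa using hi)))
  have hkey : (δ' : MvPolynomial (Fin n) K) * (G * ω L) ∈ J := by
    have : (δ' : MvPolynomial (Fin n) K) * (G * ω L) =
        ∑ i, (X L * pderiv i F) * ξ i - ∑ i, pderiv i G * (X L * ω i - X i * ω L) := by
      have e1 : (δ' : MvPolynomial (Fin n) K) * (G * ω L) = (∑ i, X i * pderiv i G) * ω L := by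
        rw [hEG, nsmul_eq_mul]; ring
      have e2 : ∑ i, (X L * pderiv i F) * ξ i = X L * ∑ i, pderiv i G * ω i := by
        rw [h2, Finset.mul_sum]
        exact Finset.sum_congr rfl fun i _ => by ring
      rw [e1, e2, Finset.mul_sum, Finset.sum_mul, ← Finset.sum_sub_distrib]
      exact Finset.sum_congr rfl fun i _ => by ring
    rw [this]
    refine sub_mem (Ideal.sum_mem _ fun i _ => Ideal.mul_mem_right _ _ ?_)
      (Ideal.sum_mem _ fun i _ => Ideal.mul_mem_left _ _ (hs i))
    by_cases hi : i = L
    · rw [hi]; exact hXL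
    · exact Ideal.mul_mem_left _ _ (hFJ i hi)
  have hδ'0 : (δ' : K) ≠ 0 := by
    rw [ne_eq, CharP.cast_eq_zero_iff K p]; exact hpδ'
  have := Ideal.mul_mem_left J (C ((δ' : K)⁻¹)) hkey
  rwa [← mul_assoc, ← map_natCast (C : K →+* MvPolynomial (Fin n) K), ← C_mul,
    inv_mul_cancel₀ hδ'0, C_1, one_mul] at this

end
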